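/- For any circular matrix A of order m×n and any b ∈ ℤ^m with b ≥ 0, the polyhedron Q*(A,b) is completely described by the inequalities x ≥ 0 and Ax ≥ b together with the Γ-inequalities over all simple directed circuits Γ in D(A) with p(Γ) ≥ 2 such that p(Γ) does not divide t(Γ,b); that is, Q*(A,b) equals the set of x ∈ ℝⁿ satisfying x ≥ 0, Ax ≥ b, and all such Γ-inequalities. -/

import Mathlib

namespace CircCover

attribute [local instance] Classical.propDecidable

/-- Membership in the circular interval `[a, a + k)ₙ` of `ZMod n`. -/
def inInterval {n : ℕ} (a : ZMod n) (k : ℕ) (j : ZMod n) : Prop :=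
  ∃ s : ℕ, s < k ∧ j = a + (s : ZMod n)

/-- The `{0,1}`-matrix whose `i`-th row is the incidence vector of `[ℓ i, ℓ i + k i)ₙ`. -/
noncomputable def circMatrix {m n : ℕ} (ℓ : Fin m → ZMod n) (k : Fin m → ℕ) :
    Matrix (Fin m) (ZMod n) ℝ :=
  fun i j => if inInterval (ℓ i) (k i) j then 1 else 0

/-- The condition `2 ≤ kᵢ ≤ n - 1` making `circMatrix ℓ k` a circular matrix. -/
def circBounds (n : ℕ) {m : ℕ} (k : Fin m → ℕ) : Prop :=
  ∀ i, 2 ≤ k i ∧ k i ≤ n - 1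

/-- Arcs of the digraph `D(A)` associated with a circular matrix. -/
inductive Arc (m n : ℕ) : Type
  | fwdRow (i : Fin m)
  | fwdShort (j : ZMod n)
  | revRow (i : Fin m)
  | revShort (j : ZMod n)
  deriving DecidableEq

namespace Arc

variable {m n : ℕ} (ℓ : Fin m → ZMod n) (k : Fin m → ℕ)

/-- The tail of an arc of `D(A)`. -/
def tail : Arc m n → ZMod n
  | fwdRow i => ℓ i - 1
  | fwdShort j => j - 1
  | revRow i => ℓ i + (k i : ZMod n) - 1
  | revShort j => j

/-- The head of an arc of `D(A)`. -/
def head : Arc m n → ZMod n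
  | fwdRow i => ℓ i + (k i : ZMod n) - 1
  | fwdShort j => j
  | revRow i => ℓ i - 1
  | revShort j => j - 1

/-- The oriented length of an arc of `D(A)`. -/
def len (k : Fin m → ℕ) : Arc m n → ℤ
  | fwdRow i => (k i : ℤ)
  | fwdShort _ => 1
  | revRow i => -(k i : ℤ)
  | revShort _ => -1

/-- Forward arcs. -/
def IsForward : Arc m n → Prop
  | fwdRow _ => True
  | fwdShort _ => True
  | _ => False

/-- Forward row arcs. -/
def IsFwdRow : Arc m n → Prop
  | fwdRow _ => True
  | _ => False

/-- Reverse row arcs. -/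
def IsRevRow : Arc m n → Prop
  | revRow _ => True
  | _ => False

/-- Forward short arcs. -/
def IsFwdShort : Arc m n → Prop
  | fwdShort _ => True
  | _ => False

/-- The arc jumps over node `j`. -/
def Jumps : Arc m n → ZMod n → Prop
  | fwdRow i, j => inInterval (ℓ i) (k i) j
  | fwdShort j', j => j' = j
  | revRow i, j => inInterval (ℓ i) (k i) j
  | revShort j', j => j' = j

end Arc

variable {m n : ℕ}

/-- A (not necessarily simple) closed directed path in `D(A)`, given as its list of arcs. -/
def IsClosedWalk (ℓ : Fin m → ZMod n) (k : Fin m → ℕ) (γ : List (Arc m n)) : Prop :=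
  ∃ h : γ ≠ [],
    List.Chain' (fun a b => Arc.head ℓ k a = Arc.tail ℓ k b) γ ∧
      Arc.head ℓ k (γ.getLast h) = Arc.tail ℓ k (γ.head h)

/-- A simple directed circuit in `D(A)`: a closed directed path visiting pairwise
distinct nodes. -/
def IsCircuit (ℓ : Fin m → ZMod n) (k : Fin m → ℕ) (γ : List (Arc m n)) : Prop :=
  IsClosedWalk ℓ k γ ∧ (γ.map (Arc.tail ℓ k)).Nodup

/-- The sum of the oriented lengths of the arcs of `γ`; it equals `p(γ) * n` where `p(γ)`
is the winding number. -/
def windingSum (k : Fin m → ℕ) (γ : List (Arc m n)) : ℤ :=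
  (γ.map (Arc.len k)).sum

/-- `p⁺(γ, j)`: the number of forward arcs of `γ` jumping over `j`. -/
noncomputable def pPlus (ℓ : Fin m → ZMod n) (k : Fin m → ℕ) (γ : List (Arc m n))
    (j : ZMod n) : ℕ :=
  γ.countP fun a => decide (Arc.IsForward a ∧ Arc.Jumps ℓ k a j)

/-- `p⁻(γ, j)`: the number of reverse arcs of `γ` jumping over `j`. -/
noncomputable def pMinus (ℓ : Fin m → ZMod n) (k : Fin m → ℕ) (γ : List (Arc m n))
    (j : ZMod n) : ℕ :=
  γ.countP fun a => decide (¬ Arc.IsForward a ∧ Arc.Jumps ℓ k a j)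

/-- The number of (forward) row arcs of `γ` jumping over `j`. -/
noncomputable def rowJumpCount (ℓ : Fin m → ZMod n) (k : Fin m → ℕ) (γ : List (Arc m n))
    (j : ZMod n) : ℕ :=
  γ.countP fun a => decide (Arc.IsFwdRow a ∧ Arc.Jumps ℓ k a j)

/-- The number of forward row arcs of `γ`. -/
def numRowArcs (γ : List (Arc m n)) : ℕ :=
  γ.countP fun a => match a with | Arc.fwdRow _ => true | _ => false

/-- `t(γ, b) = ∑_{aᵢ ∈ γ} bᵢ - ∑_{āᵢ ∈ γ} bᵢ`. -/
def tVal (b : Fin m → ℤ) (γ : List (Arc m n)) : ℤ :=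
  (γ.map fun a => match a with
    | Arc.fwdRow i => b i
    | Arc.revRow i => -(b i)
    | _ => 0).sum

/-- `t⁻(γ, b) = ∑_{āᵢ ∈ γ} bᵢ`. -/
def tMinusVal (b : Fin m → ℤ) (γ : List (Arc m n)) : ℤ :=
  (γ.map fun a => match a with
    | Arc.revRow i => b i
    | _ => 0).sum

/-- `β(γ, b) = ⌊t(γ, b) / p⌋`. -/
def betaVal (b : Fin m → ℤ) (γ : List (Arc m n)) (p : ℤ) : ℤ :=
  Int.fdiv (tVal b γ) p

/-- `r(γ, b) = t(γ, b) - β(γ, b) * p`. -/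
def rVal (b : Fin m → ℤ) (γ : List (Arc m n)) (p : ℤ) : ℤ :=
  tVal b γ - betaVal b γ p * p

/-- The `γ`-inequality `∑ⱼ (p⁻(γ,j) + r) xⱼ ≥ r (β + 1) + ∑_{āᵢ ∈ γ} bᵢ`. -/
def GammaIneqHolds [NeZero n] (ℓ : Fin m → ZMod n) (k : Fin m → ℕ) (b : Fin m → ℤ)
    (γ : List (Arc m n)) (p : ℤ) (x : ZMod n → ℝ) : Prop :=
  ∑ j : ZMod n, ((pMinus ℓ k γ j : ℝ) + (rVal b γ p : ℝ)) * x j ≥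
    (rVal b γ p : ℝ) * ((betaVal b γ p : ℝ) + 1) + (tMinusVal b γ : ℝ)

/-- The fractional covering polyhedron `Q(A, b) = {x ≥ 0 : A x ≥ b}`. -/
def Qpoly [NeZero n] (A : Matrix (Fin m) (ZMod n) ℝ) (b : Fin m → ℝ) :
    Set (ZMod n → ℝ) :=
  {x | (∀ j, 0 ≤ x j) ∧ ∀ i, b i ≤ ∑ j : ZMod n, A i j * x j}

/-- A point of `ℝⁿ` all whose coordinates are integers. -/
def IsIntegerPoint {n : ℕ} (x : ZMod n → ℝ) : Prop :=
  ∀ j, ∃ z : ℤ, x j = (z : ℝ)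

/-- The covering polyhedron `Q*(A, b) = conv{x ∈ ℤⁿ : x ≥ 0, A x ≥ b}`. -/
noncomputable def Qstar [NeZero n] (A : Matrix (Fin m) (ZMod n) ℝ) (b : Fin m → ℝ) :
    Set (ZMod n → ℝ) :=
  convexHull ℝ {x | IsIntegerPoint x ∧ x ∈ Qpoly A b}

/-- The slack of row `i` of `A` at the point `x`. -/
noncomputable def rowSlack [NeZero n] (ℓ : Fin m → ZMod n) (k : Fin m → ℕ)
    (b : Fin m → ℤ) (x : ZMod n → ℝ) (i : Fin m) : ℝ :=
  (∑ j : ZMod n, circMatrix ℓ k i j * x j) - (b i : ℝ)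

/-- `μ = ⌈1ᵀ x⌉ - 1ᵀ x`. -/
noncomputable def muVal [NeZero n] (x : ZMod n → ℝ) : ℝ :=
  (⌈∑ j : ZMod n, x j⌉ : ℝ) - ∑ j : ZMod n, x j

/-- Entry `i` of the last column `v` of `Ã` (the column indexed by `n ≡ 0`). -/
noncomputable def vRow (ℓ : Fin m → ZMod n) (k : Fin m → ℕ) (i : Fin m) : ℝ :=
  circMatrix ℓ k i 0

/-- Entry `m + j` of the last column `v` of `Ã`. -/
noncomputable def vShort (j : ZMod n) : ℝ :=
  if j = 0 then 1 else 0

/-- The cost of an arc in the weighted digraph `D(A, x)`: forward arcs carry the cost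
`c⁺ = μ (s* - (1 - μ) v)` and reverse arcs the cost `c⁻ = (1 - μ)(s* + μ v)`. -/
noncomputable def arcCost [NeZero n] (ℓ : Fin m → ZMod n) (k : Fin m → ℕ)
    (b : Fin m → ℤ) (x : ZMod n → ℝ) : Arc m n → ℝ
  | Arc.fwdRow i => muVal x * (rowSlack ℓ k b x i - (1 - muVal x) * vRow ℓ k i)
  | Arc.fwdShort j => muVal x * (x j - (1 - muVal x) * vShort j)
  | Arc.revRow i => (1 - muVal x) * (rowSlack ℓ k b x i + muVal x * vRow ℓ k i)
  | Arc.revShort j => (1 - muVal x) * (x j + muVal x * vShort j)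

/-- The cost `c(γ, x)` of a walk `γ` in `D(A, x)`. -/
noncomputable def walkCost [NeZero n] (ℓ : Fin m → ZMod n) (k : Fin m → ℕ)
    (b : Fin m → ℤ) (x : ZMod n → ℝ) (γ : List (Arc m n)) : ℝ :=
  (γ.map (arcCost ℓ k b x)).sum

/-- Row `i` dominates row `i'` of `A`. -/
def Dominates (A : Matrix (Fin m) (ZMod n) ℝ) (i i' : Fin m) : Prop :=
  i ≠ i' ∧ ∀ j, A i' j ≤ A i j

/-- `A` has no dominating rows. -/
def NoDominatingRows (A : Matrix (Fin m) (ZMod n) ℝ) : Prop :=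
  ∀ i i', ¬ Dominates A i i'

/-- The affine dimension of a subset of `ℝⁿ` (`-1` for the empty set). -/
noncomputable def adim [NeZero n] (S : Set (ZMod n → ℝ)) : ℤ :=
  if S = ∅ then -1 else (Module.finrank ℝ (affineSpan ℝ S).direction : ℤ)

/-- The valid inequality `aᵀ x ≥ α₀` defines a facet of `P`:
the face it defines has affine dimension `dim P - 1`. -/
def IsFacetIneq [NeZero n] (P : Set (ZMod n → ℝ)) (a : ZMod n → ℝ) (α₀ : ℝ) : Prop :=
  (∀ x ∈ P, α₀ ≤ ∑ j : ZMod n, a j * x j) ∧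
    adim {x ∈ P | ∑ j : ZMod n, a j * x j = α₀} = adim P - 1

/-- `j` is a node of the walk `γ`. -/
def IsNodeOf (ℓ : Fin m → ZMod n) (k : Fin m → ℕ) (γ : List (Arc m n)) (j : ZMod n) : Prop :=
  ∃ a ∈ γ, Arc.tail ℓ k a = j

/-- `j` is an essential bullet of `γ`: a node of `γ` which is neither a circle
(head of a forward short arc of `γ`) nor a cross (tail of a reverse short arc of `γ`). -/
def IsEssentialBullet (ℓ : Fin m → ZMod n) (k : Fin m → ℕ) (γ : List (Arc m n))
    (j : ZMod n) : Prop :=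
  IsNodeOf ℓ k γ j ∧ Arc.fwdShort j ∉ γ ∧ Arc.revShort j ∉ γ

/-- The number of essential bullets of `γ`. -/
noncomputable def numEssentialBullets [NeZero n] (ℓ : Fin m → ZMod n) (k : Fin m → ℕ)
    (γ : List (Arc m n)) : ℕ :=
  (Finset.univ.filter fun j : ZMod n => IsEssentialBullet ℓ k γ j).card

/-- `∑_{i ∈ F} a_{ij}`, the number of rows of `F` whose interval contains `j`. -/
noncomputable def rowCount (ℓ : Fin m → ZMod n) (k : Fin m → ℕ) (F : Finset (Fin m))
    (j : ZMod n) : ℕ :=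
  (F.filter fun i => inInterval (ℓ i) (k i) j).card

/-- The row family inequality induced by `F` (with `p* = max_j ∑_{i ∈ F} a_{ij} - 1`). -/
def RowFamilyIneqHolds [NeZero n] (ℓ : Fin m → ZMod n) (k : Fin m → ℕ)
    (F : Finset (Fin m)) (x : ZMod n → ℝ) : Prop :=
  let s := F.card
  let pstar := (Finset.univ.sup fun j : ZMod n => rowCount ℓ k F j) - 1
  let rstar := s - pstar * (s / pstar)
  ((rstar : ℝ) + 1) * ∑ j ∈ Finset.univ.filter (fun j : ZMod n => rowCount ℓ k F j = pstar + 1), x j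
    + (rstar : ℝ) * ∑ j ∈ Finset.univ.filter (fun j : ZMod n => rowCount ℓ k F j ≤ pstar), x j
    ≥ (rstar : ℝ) * (((s + pstar - 1) / pstar : ℕ) : ℝ)


section Digraph

variable {V E : Type*} (s t : E → V)

/-- `γ` is the list of arcs of a directed walk from `u` to `v`, where the arc `e` goes from
`s e` to `t e`. -/
def IsWalk : V → List E → V → Prop
  | u, [], v => u = v
  | u, e :: γ, v => s e = u ∧ IsWalk (t e) γ v

variable {s t}

theorem isWalk_append {γ δ : List E} {u w : V} :
    IsWalk s t u (γ ++ δ) w ↔ ∃ v, IsWalk s t u γ v ∧ IsWalk s t v δ w := by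
  induction γ generalizing u with
  | nil => simp [IsWalk]
  | cons e γ ih => simp [IsWalk, ih, and_assoc]

theorem isWalk_iff_isChain {γ : List E} (h : γ ≠ []) {u v : V} :
    IsWalk s t u γ v ↔
      γ.IsChain (fun a b => t a = s b) ∧ s (γ.head h) = u ∧ t (γ.getLast h) = v := by
  induction γ generalizing u with
  | nil => exact absurd rfl h
  | cons e γ ih =>
    cases γ with
    | nil => simp [IsWalk]
    | cons e' γ =>
      rw [IsWalk, ih (by simp)]
      simp only [List.isChain_cons_cons, List.head_cons, List.getLast_cons_cons]
      constructor
      · rintro ⟨h1, h2, h3, h4⟩; exact ⟨⟨h3.symm, h2⟩, h1, h4⟩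
      · rintro ⟨⟨h3, h2⟩, h1, h4⟩; exact ⟨h1, h2, h3.symm, h4⟩

theorem IsWalk.sum_sub {γ : List E} {u v : V} (h : IsWalk s t u γ v) (f : V → ℝ) :
    (γ.map fun e => f (t e) - f (s e)).sum = f v - f u := by
  induction γ generalizing u with
  | nil => simp [show u = v from h]
  | cons e γ ih =>
    obtain ⟨rfl, h⟩ := h
    simp [ih h]

/-- A finite weighted digraph without negative simple circuits has a feasible potential. -/
theorem exists_potential [Finite E] (c : E → ℝ)
    (hc : ∀ γ ≠ [], ∀ u, IsWalk s t u γ u → (γ.map s).Nodup → 0 ≤ (γ.map c).sum) :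
    ∃ f : V → ℝ, ∀ e, f (t e) - f (s e) ≤ c e := by
  have := Fintype.ofFinite E
  let P : V → Set (List E) := fun v => {γ | (∃ u, IsWalk s t u γ v) ∧ (γ.map s ++ [v]).Nodup}
  have hfin : ∀ v, (P v).Finite := fun v => by
    refine (List.finite_length_le E (Fintype.card E)).subset fun γ hγ => ?_
    exact (List.Nodup.of_map s (List.nodup_append.1 hγ.2).1).length_le_card
  have hne : ∀ v, (P v).Nonempty := fun v => ⟨[], ⟨v, rfl⟩, by simp⟩
  choose γ hγ hmin using fun v =>
    Set.exists_min_image (P v) (fun γ => (γ.map c).sum) (hfin v) (hne v)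
  refine ⟨fun v => ((γ v).map c).sum, fun e => ?_⟩
  obtain ⟨⟨u, hw⟩, hnd⟩ := hγ (s e)
  set δ := γ (s e) ++ [e] with hδ
  have hwδ : IsWalk s t u δ (t e) := isWalk_append.2 ⟨s e, hw, rfl, rfl⟩
  have hndδ : (δ.map s).Nodup := by simpa [hδ] using hnd
  have hsum : (δ.map c).sum = ((γ (s e)).map c).sum + c e := by simp [hδ]
  suffices ((γ (t e)).map c).sum ≤ (δ.map c).sum by simp only; linarith
  by_cases hmem : t e ∈ δ.map s
  · obtain ⟨a, ha, hat⟩ := List.mem_map.1 hmem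
    obtain ⟨δ₁, δ₂, h12⟩ := List.append_of_mem ha
    rw [h12] at hwδ hndδ ⊢
    obtain ⟨v, h1, h2⟩ := isWalk_append.1 hwδ
    obtain rfl : v = t e := h2.1.symm.trans hat
    have hp : δ₁ ∈ P (t e) := by
      refine ⟨⟨u, h1⟩, hndδ.sublist ?_⟩
      simp [hat]
    have hcirc := hc (a :: δ₂) (by simp) _ h2
      (hndδ.sublist ((List.sublist_append_right _ _).map s))
    have := hmin (t e) δ₁ hp
    rw [List.map_append, List.sum_append]
    linarith
  · refine hmin (t e) δ ⟨⟨u, hwδ⟩, ?_⟩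
    rw [List.nodup_append]
    refine ⟨hndδ, by simp, ?_⟩
    rintro a ha b hb rfl
    exact hmem (List.mem_singleton.1 hb ▸ ha)

end Digraph

section Rounding

open MeasureTheory

theorem integral_floor_add (a : ℝ) :
    IntegrableOn (fun θ : ℝ => (⌊a + θ⌋ : ℝ)) (Set.Ico 0 1) ∧
      ∫ θ in Set.Ico (0 : ℝ) 1, (⌊a + θ⌋ : ℝ) = a := by
  have h0 := Int.fract_nonneg a
  have h1 := Int.fract_lt_one a
  have hEq : Set.EqOn (fun θ : ℝ => (⌊a + θ⌋ : ℝ))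
      (fun θ => (⌊a⌋ : ℝ) + (Set.Ico (1 - Int.fract a) 1).indicator (fun _ => (1 : ℝ)) θ)
      (Set.Ico 0 1) := by
    intro θ hθ
    have ha := Int.floor_add_fract a
    by_cases h : 1 - Int.fract a ≤ θ
    · have : ⌊a + θ⌋ = ⌊a⌋ + 1 := by
        rw [Int.floor_eq_iff]; push_cast; constructor <;> linarith [hθ.2]
      simp [this, Set.indicator, h, hθ.2]
    · have : ⌊a + θ⌋ = ⌊a⌋ := by
        rw [Int.floor_eq_iff]; constructor <;> linarith [hθ.1]
      simp [this, Set.indicator, h]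
  have hi1 : IntegrableOn (fun _ : ℝ => (⌊a⌋ : ℝ)) (Set.Ico 0 1) := by simp
  have hi2 : IntegrableOn ((Set.Ico (1 - Int.fract a) 1).indicator (fun _ => (1 : ℝ)))
      (Set.Ico 0 1) := (integrableOn_const (by simp)).indicator measurableSet_Ico
  refine ⟨(hi1.add hi2).congr_fun hEq.symm measurableSet_Ico, ?_⟩
  rw [setIntegral_congr_fun measurableSet_Ico hEq, integral_add hi1 hi2,
    setIntegral_indicator measurableSet_Ico,
    Set.inter_eq_right.2 (Set.Ico_subset_Ico_left (by linarith))]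
  simp [Int.fract_nonneg]

/-- A real vector of shifted differences `f (g j) - f (h j) + c j` lies in the convex hull of the
vectors obtained by replacing `f` with its roundings `⌊f + θ⌋`. -/
theorem mem_convexHull_floor {ι κ : Type*} [Finite ι] [Fintype κ] (f : ι → ℝ) (S : Set (κ → ℝ))
    (g : κ → ι) (h : κ → ι) (c : κ → ℝ)
    (hS : ∀ θ : ℝ, (fun j => (⌊f (g j) + θ⌋ : ℝ) - ⌊f (h j) + θ⌋ + c j) ∈ S) :
    (fun j => f (g j) - f (h j) + c j) ∈ convexHull ℝ S := by
  let F : ℝ → κ → ℝ := fun θ j => (⌊f (g j) + θ⌋ : ℝ) - ⌊f (h j) + θ⌋ + c j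
  have hfin : (F '' Set.Ico 0 1).Finite := by
    refine (Set.Finite.pi' fun i => Set.finite_Icc ⌊f i⌋ (⌊f i⌋ + 1)).image
      (fun z : ι → ℤ => fun j => ((z (g j) : ℝ) - z (h j) + c j)) |>.subset ?_
    rintro _ ⟨θ, hθ, rfl⟩
    refine ⟨fun i => ⌊f i + θ⌋, fun i => ⟨Int.floor_mono (by linarith [hθ.1]), ?_⟩, rfl⟩
    rw [← Int.floor_add_one]
    exact Int.floor_mono (by linarith [hθ.2])
  have hsub : convexHull ℝ (F '' Set.Ico 0 1) ⊆ convexHull ℝ S :=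
    convexHull_mono (by rintro _ ⟨θ, -, rfl⟩; exact hS θ)
  apply hsub
  have : IsProbabilityMeasure (volume.restrict (Set.Ico (0 : ℝ) 1)) := ⟨by simp⟩
  have hint : ∀ j, IntegrableOn (fun θ => F θ j) (Set.Ico 0 1) := fun j =>
    ((integral_floor_add _).1.sub (integral_floor_add _).1).add (by simp)
  have hF : IntegrableOn F (Set.Ico 0 1) := Integrable.of_eval hint
  have key := (convex_convexHull ℝ (F '' Set.Ico 0 1)).integral_mem
    (μ := volume.restrict (Set.Ico (0 : ℝ) 1)) (f := F)
    (hfin.isCompact_convexHull (𝕜 := ℝ)).isClosed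
    ((ae_restrict_iff' measurableSet_Ico).2 (.of_forall fun θ hθ =>
      subset_convexHull ℝ _ ⟨θ, hθ, rfl⟩)) hF
  convert key using 1
  ext j
  rw [eval_integral hint]
  simp only [F]
  have hsub : IntegrableOn (fun θ => (⌊f (g j) + θ⌋ : ℝ) - ⌊f (h j) + θ⌋) (Set.Ico 0 1) :=
    (integral_floor_add _).1.sub (integral_floor_add _).1
  rw [integral_add hsub (by simp), integral_sub (integral_floor_add _).1 (integral_floor_add _).1,
    (integral_floor_add _).2, (integral_floor_add _).2]
  simp

end Rounding

namespace Arc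

/-- `1` for forward arcs and `-1` for reverse arcs. -/
def sign : Arc m n → ℤ
  | fwdRow _ => 1
  | fwdShort _ => 1
  | revRow _ => -1
  | revShort _ => -1

/-- The right-hand side of the constraint attached to an arc. -/
def demand (b : Fin m → ℤ) : Arc m n → ℤ
  | fwdRow i => b i
  | fwdShort _ => 0
  | revRow i => b i
  | revShort _ => 0

/-- The total weight under `x` of the nodes an arc jumps over. -/
noncomputable def load [NeZero n] (ℓ : Fin m → ZMod n) (k : Fin m → ℕ) (x : ZMod n → ℝ) :
    Arc m n → ℝ
  | fwdRow i => ∑ j, circMatrix ℓ k i j * x j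
  | fwdShort j => x j
  | revRow i => ∑ j, circMatrix ℓ k i j * x j
  | revShort j => x j

/-- `1` if the arc jumps over `0`, and `0` otherwise. -/
noncomputable def cross (ℓ : Fin m → ZMod n) (k : Fin m → ℕ) : Arc m n → ℤ
  | fwdRow i => if inInterval (ℓ i) (k i) 0 then 1 else 0
  | fwdShort j => if j = 0 then 1 else 0
  | revRow i => if inInterval (ℓ i) (k i) 0 then 1 else 0
  | revShort j => if j = 0 then 1 else 0

/-- The slack at `x` of the constraint attached to an arc. -/
noncomputable def slack [NeZero n] (ℓ : Fin m → ZMod n) (k : Fin m → ℕ) (b : Fin m → ℤ)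
    (x : ZMod n → ℝ) (a : Arc m n) : ℝ :=
  a.load ℓ k x - a.demand b

instance [NeZero n] : Finite (Arc m n) := by
  let F : (Fin m ⊕ ZMod n) ⊕ (Fin m ⊕ ZMod n) → Arc m n :=
    Sum.elim (Sum.elim fwdRow fwdShort) (Sum.elim revRow revShort)
  refine Finite.of_surjective F fun a => ?_
  cases a with
  | fwdRow i => exact ⟨.inl (.inl i), rfl⟩
  | fwdShort j => exact ⟨.inl (.inr j), rfl⟩
  | revRow i => exact ⟨.inr (.inl i), rfl⟩
  | revShort j => exact ⟨.inr (.inr j), rfl⟩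

end Arc

open Arc

section Potential

variable [NeZero n]

theorem sum_inInterval {k : ℕ} (hk : k ≤ n) (a : ZMod n) (x : ZMod n → ℝ) :
    ∑ j, (if inInterval a k j then x j else 0) = ∑ s ∈ Finset.range k, x (a + s) := by
  have hinj : Set.InjOn (fun s : ℕ => a + (s : ZMod n)) (Finset.range k) := by
    intro s hs s' hs' h
    have h' := (ZMod.natCast_eq_natCast_iff' s s' n).1 (add_left_cancel h)
    simp only [Finset.coe_range, Set.mem_Iio] at hs hs'
    rwa [Nat.mod_eq_of_lt (hs.trans_le hk), Nat.mod_eq_of_lt (hs'.trans_le hk)] at h'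
  rw [← Finset.sum_filter, ← Finset.sum_image hinj]
  refine Finset.sum_congr (Finset.ext fun j => ?_) fun _ _ => rfl
  rw [Finset.mem_filter_univ, Finset.mem_image]
  simp only [inInterval, Finset.mem_range, eq_comm]

theorem sum_circMatrix_mul {ℓ : Fin m → ZMod n} {k : Fin m → ℕ} (hA : circBounds n k)
    (i : Fin m) (x : ZMod n → ℝ) :
    ∑ j, circMatrix ℓ k i j * x j = ∑ s ∈ Finset.range (k i), x (ℓ i + s) := by
  rw [← sum_inInterval ((hA i).2.trans (Nat.sub_le _ _))]
  simp [circMatrix]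

/-- The vector of differences of the potential `f`, with total sum `c`. -/
noncomputable def ofPotential (f : ZMod n → ℝ) (c : ℝ) (j : ZMod n) : ℝ :=
  f j - f (j - 1) + if j = 0 then c else 0

theorem sum_ofPotential (f : ZMod n → ℝ) (c : ℝ) : ∑ j, ofPotential f c j = c := by
  simp only [ofPotential, Finset.sum_add_distrib, Finset.sum_sub_distrib]
  rw [Fintype.sum_equiv (Equiv.subRight (1 : ZMod n)) (fun j => f (j - 1)) f (fun _ => rfl)]
  simp

theorem exists_eq_ofPotential (x : ZMod n → ℝ) : ∃ f, x = ofPotential f (∑ j, x j) := by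
  refine ⟨fun j => ∑ s ∈ Finset.range j.val, x (s + 1), funext fun j => ?_⟩
  obtain ⟨r, hr⟩ : ∃ r, n = r + 1 := ⟨n - 1, by have := NeZero.pos n; omega⟩
  subst hr
  by_cases hj : j = 0
  · subst hj
    have h1 : (0 - 1 : ZMod (r + 1)).val = r := by rw [zero_sub, ZMod.val_neg_one]
    have h2 : ∑ j, x j = ∑ s ∈ Finset.range (r + 1), x s := by
      have := sum_inInterval (n := r + 1) le_rfl 0 x
      simp only [zero_add] at this
      rw [← this]
      refine Finset.sum_congr rfl fun j _ => (if_pos ?_).symm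
      exact ⟨j.val, ZMod.val_lt j, by simp⟩
    simp only [ofPotential, h1, h2, Finset.sum_range_succ']
    simp
  · have h1 : j.val = (j - 1).val + 1 := by
      have h3 : j.val ≠ 0 := fun h => hj ((ZMod.val_eq_zero j).1 h)
      have : j - 1 = ((j.val - 1 : ℕ) : ZMod (r + 1)) := by
        rw [Nat.cast_sub (by omega)]; simp
      rw [this, ZMod.val_cast_of_lt (by have := ZMod.val_lt j; omega)]
      omega
    simp only [ofPotential, if_neg hj]
    rw [h1, Finset.sum_range_succ]
    simp

theorem Arc.load_ofPotential {ℓ : Fin m → ZMod n} {k : Fin m → ℕ} (hA : circBounds n k)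
    (f : ZMod n → ℝ) (c : ℝ) (a : Arc m n) :
    a.load ℓ k (ofPotential f c) =
      a.sign * (f (a.head ℓ k) - f (a.tail ℓ k)) + c * a.cross ℓ k := by
  have hrow : ∀ i, ∑ j, circMatrix ℓ k i j * ofPotential f c j =
      f (ℓ i + k i - 1) - f (ℓ i - 1) + c * if inInterval (ℓ i) (k i) 0 then 1 else 0 := by
    intro i
    simp only [ofPotential, mul_add, Finset.sum_add_distrib]
    congr 1
    · rw [sum_circMatrix_mul hA i fun j => f j - f (j - 1)]
      have h3 := Finset.sum_range_sub (fun s : ℕ => f (ℓ i + s - 1)) (k i)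
      simp only [Nat.cast_zero, add_zero] at h3
      rw [← h3]
      refine Finset.sum_congr rfl fun s _ => ?_
      push_cast
      ring_nf
    · simp [circMatrix]
  cases a with
  | fwdRow i => simp [load, sign, cross, head, tail, hrow]
  | revRow i => simp [load, sign, cross, head, tail, hrow]
  | fwdShort j => simp [load, sign, cross, head, tail, ofPotential]
  | revShort j => simp [load, sign, cross, head, tail, ofPotential]

theorem Arc.sign_mul_load_one {ℓ : Fin m → ZMod n} {k : Fin m → ℕ} (hA : circBounds n k)
    (a : Arc m n) : a.sign * a.load ℓ k (fun _ => 1) = a.len k := by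
  cases a with
  | fwdShort j => simp [load, sign, len]
  | revShort j => simp [load, sign, len]
  | fwdRow i => rw [load, sum_circMatrix_mul hA]; simp [sign, len]
  | revRow i => rw [load, sum_circMatrix_mul hA]; simp [sign, len]

end Potential

section Circuit

variable {ℓ : Fin m → ZMod n} {k : Fin m → ℕ} {b : Fin m → ℤ} {γ : List (Arc m n)} {u : ZMod n}

theorem IsCircuit.exists_isWalk (h : IsCircuit ℓ k γ) :
    ∃ u, IsWalk (Arc.tail ℓ k) (Arc.head ℓ k) u γ u := by
  obtain ⟨⟨hne, hch, hcl⟩, -⟩ := h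
  exact ⟨_, (isWalk_iff_isChain hne).2 ⟨hch, rfl, hcl⟩⟩

theorem IsWalk.isCircuit (h : IsWalk (Arc.tail ℓ k) (Arc.head ℓ k) u γ u) (hne : γ ≠ [])
    (hnd : (γ.map (Arc.tail ℓ k)).Nodup) : IsCircuit ℓ k γ := by
  obtain ⟨h1, h2, h3⟩ := (isWalk_iff_isChain hne).1 h
  exact ⟨⟨hne, h1, h3.trans h2.symm⟩, hnd⟩

theorem tVal_cons (a : Arc m n) : tVal b (a :: γ) = a.sign * a.demand b + tVal b γ := by
  cases a <;> simp [tVal, sign, demand]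

variable [NeZero n] {x : ZMod n → ℝ}

theorem mem_Qpoly_of_forall_sign (σ : ℤ) (hσ : σ = 1 ∨ σ = -1)
    (h : ∀ a : Arc m n, a.sign = σ → 0 ≤ a.slack ℓ k b x) :
    x ∈ Qpoly (circMatrix ℓ k) (fun i => (b i : ℝ)) := by
  rcases hσ with rfl | rfl
  · exact ⟨fun j => by simpa [slack, load, demand] using h (.fwdShort j) rfl,
      fun i => by simpa [slack, load, demand] using h (.fwdRow i) rfl⟩
  · exact ⟨fun j => by simpa [slack, load, demand] using h (.revShort j) rfl,
      fun i => by simpa [slack, load, demand] using h (.revRow i) rfl⟩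

theorem mem_Qpoly_iff_slack_nonneg :
    x ∈ Qpoly (circMatrix ℓ k) (fun i => (b i : ℝ)) ↔ ∀ a : Arc m n, 0 ≤ a.slack ℓ k b x := by
  refine ⟨?_, fun h => mem_Qpoly_of_forall_sign 1 (.inl rfl) fun a _ => h a⟩
  rintro ⟨h1, h2⟩ (i | j | i | j)
  · simpa [slack, load, demand] using h2 i
  · simpa [slack, load, demand] using h1 j
  · simpa [slack, load, demand] using h2 i
  · simpa [slack, load, demand] using h1 j

theorem IsWalk.sum_sign_load (h : IsWalk (Arc.tail ℓ k) (Arc.head ℓ k) u γ u)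
    (hA : circBounds n k) (x : ZMod n → ℝ) :
    (γ.map fun a => (a.sign : ℝ) * a.load ℓ k x).sum =
      (∑ j, x j) * (γ.map fun a => a.sign * a.cross ℓ k).sum := by
  obtain ⟨f, hf⟩ := exists_eq_ofPotential x
  have key : (γ.map fun a => (a.sign : ℝ) * a.load ℓ k x).sum =
      (γ.map fun a => f (a.head ℓ k) - f (a.tail ℓ k)).sum +
        (∑ j, x j) * (γ.map fun a => a.sign * a.cross ℓ k).sum := by
    clear h
    induction γ with
    | nil => simp
    | cons a γ ih =>
      have h1 := load_ofPotential hA f (∑ j, x j) a (ℓ := ℓ)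
      rw [← hf] at h1
      have h2 : (a.sign : ℝ) * a.sign = 1 := by cases a <;> simp [sign]
      simp only [List.map_cons, List.sum_cons, ih, h1]
      push_cast
      linear_combination (f (a.head ℓ k) - f (a.tail ℓ k)) * h2
  rw [key, h.sum_sub, sub_self, zero_add]

theorem IsWalk.windingSum_eq (h : IsWalk (Arc.tail ℓ k) (Arc.head ℓ k) u γ u)
    (hA : circBounds n k) :
    (γ.map fun a => a.sign * a.cross ℓ k).sum * (n : ℤ) = windingSum k γ := by
  have h1 := h.sum_sign_load hA fun _ => 1
  have h2 : (γ.map fun a => (a.sign : ℝ) * a.load ℓ k (fun _ => 1)).sum = (windingSum k γ : ℝ) := by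
    simp [windingSum, sign_mul_load_one hA, List.map_map, Function.comp_def]
  rw [h2] at h1
  simp only [Finset.sum_const, Finset.card_univ, ZMod.card, nsmul_eq_mul, mul_one] at h1
  have h3 : windingSum k γ = (n : ℤ) * (γ.map fun a => a.sign * a.cross ℓ k).sum := by
    exact_mod_cast h1
  rw [h3, mul_comm]

/-- The total slack at `x` of the reverse arcs of `γ`. -/
noncomputable def revSlack (ℓ : Fin m → ZMod n) (k : Fin m → ℕ) (b : Fin m → ℤ)
    (x : ZMod n → ℝ) (γ : List (Arc m n)) : ℝ :=
  ∑ j, (pMinus ℓ k γ j : ℝ) * x j - tMinusVal b γ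

theorem revSlack_cons (a : Arc m n) :
    revSlack ℓ k b x (a :: γ) =
      (if a.sign = 1 then 0 else a.slack ℓ k b x) + revSlack ℓ k b x γ := by
  have h1 : ∀ j, (pMinus ℓ k (a :: γ) j : ℝ) =
      pMinus ℓ k γ j + if ¬ a.IsForward ∧ a.Jumps ℓ k j then 1 else 0 := by
    intro j
    by_cases h : ¬ a.IsForward ∧ a.Jumps ℓ k j <;> simp [pMinus, h]
  simp only [revSlack, h1, add_mul, Finset.sum_add_distrib]
  rcases a with i | j | i | j
  · simp [IsForward, sign, tMinusVal]
  · simp [IsForward, sign, tMinusVal]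
  · have h2 : ∀ j, (if ¬ (revRow i : Arc m n).IsForward ∧ (revRow i).Jumps ℓ k j then (1 : ℝ)
        else 0) = circMatrix ℓ k i j := by
      intro j
      by_cases h : inInterval (ℓ i) (k i) j <;> simp [IsForward, Jumps, circMatrix, h]
    simp only [h2]
    simp [sign, tMinusVal, slack, load, demand]
    ring
  · have h2 : ∀ j', (if ¬ (revShort j : Arc m n).IsForward ∧ (revShort j).Jumps ℓ k j'
        then (1 : ℝ) else 0) = if j = j' then 1 else 0 := by
      intro j'
      by_cases h : j = j' <;> simp [IsForward, Jumps, h]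
    simp only [h2]
    simp [sign, tMinusVal, slack, load, demand]
    ring

theorem revSlack_nonneg (hx : x ∈ Qpoly (circMatrix ℓ k) (fun i => (b i : ℝ))) :
    0 ≤ revSlack ℓ k b x γ := by
  induction γ with
  | nil => simp [revSlack, pMinus, tMinusVal]
  | cons a γ ih =>
    rw [revSlack_cons]
    have := mem_Qpoly_iff_slack_nonneg.1 hx a
    split_ifs <;> linarith

/-- The total slack of the forward arcs of a closed walk is nonnegative. -/
theorem IsWalk.fwdSlack_nonneg (h : IsWalk (Arc.tail ℓ k) (Arc.head ℓ k) u γ u)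
    (hA : circBounds n k) (hx : x ∈ Qpoly (circMatrix ℓ k) (fun i => (b i : ℝ))) :
    0 ≤ revSlack ℓ k b x γ +
      (∑ j, x j) * (γ.map fun a => a.sign * a.cross ℓ k).sum - tVal b γ := by
  rw [← h.sum_sign_load hA]
  clear h
  induction γ with
  | nil => simp [revSlack, pMinus, tMinusVal, tVal]
  | cons a γ ih =>
    rw [revSlack_cons, tVal_cons, List.map_cons, List.sum_cons]
    have := mem_Qpoly_iff_slack_nonneg.1 hx a
    push_cast
    cases a <;> simp [sign, slack] at this ih ⊢ <;> linarith

/-- The total cost of a closed walk in the digraph whose arc costs are the bounds of the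
difference constraints defining a splitting of `x` into two consecutive integer levels. -/
theorem IsWalk.sum_cost (h : IsWalk (Arc.tail ℓ k) (Arc.head ℓ k) u γ u)
    (hA : circBounds n k) (μ : ℝ) :
    (γ.map fun a => if a.sign = 1 then μ * (a.slack ℓ k b x - (1 - μ) * a.cross ℓ k)
        else (1 - μ) * (a.slack ℓ k b x + μ * a.cross ℓ k)).sum =
      μ * ((∑ j, x j - (1 - μ)) * (γ.map fun a => a.sign * a.cross ℓ k).sum - tVal b γ) +
        revSlack ℓ k b x γ := by
  rw [sub_mul, ← h.sum_sign_load hA]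
  clear h
  induction γ with
  | nil => simp [revSlack, pMinus, tMinusVal, tVal]
  | cons a γ ih =>
    rw [revSlack_cons, tVal_cons]
    simp only [List.map_cons, List.sum_cons]
    rw [ih]
    push_cast
    cases a <;> simp [sign, slack] <;> ring

theorem gammaIneqHolds_iff {p : ℤ} :
    GammaIneqHolds ℓ k b γ p x ↔
      0 ≤ revSlack ℓ k b x γ + rVal b γ p * (∑ j, x j - (betaVal b γ p + 1)) := by
  simp only [GammaIneqHolds, revSlack, add_mul, Finset.sum_add_distrib, ← Finset.mul_sum]
  constructor <;> intro h <;> linarith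

theorem IsCircuit.eq_sum_sign_cross (h : IsCircuit ℓ k γ) (hA : circBounds n k) {p : ℤ}
    (hp : p * (n : ℤ) = windingSum k γ) : (γ.map fun a => a.sign * a.cross ℓ k).sum = p := by
  obtain ⟨u, hw⟩ := h.exists_isWalk
  rw [← hw.windingSum_eq hA] at hp
  exact (mul_right_cancel₀ (by exact_mod_cast NeZero.ne n) hp).symm

theorem gammaIneqHolds_of_isIntegerPoint (hA : circBounds n k) (hγ : IsCircuit ℓ k γ) {p : ℤ}
    (hp : p * (n : ℤ) = windingSum k γ) (h2 : 2 ≤ p) (hint : IsIntegerPoint x)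
    (hx : x ∈ Qpoly (circMatrix ℓ k) (fun i => (b i : ℝ))) : GammaIneqHolds ℓ k b γ p x := by
  obtain ⟨u, hw⟩ := hγ.exists_isWalk
  rw [gammaIneqHolds_iff]
  have h1 := hw.fwdSlack_nonneg hA hx
  rw [hγ.eq_sum_sign_cross hA hp] at h1
  have h0 := revSlack_nonneg (γ := γ) hx
  choose z hz using hint
  have hσ : ∑ j, x j = ((∑ j, z j : ℤ) : ℝ) := by
    push_cast; exact Finset.sum_congr rfl fun j _ => hz j
  rw [hσ] at h1 ⊢
  generalize ∑ j, z j = N at h1 ⊢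
  have hβ : betaVal b γ p = tVal b γ / p :=
    Int.fdiv_eq_ediv_of_nonneg _ (by omega)
  have hr : rVal b γ p = tVal b γ % p := by
    rw [rVal, hβ, mul_comm, ← Int.emod_def]
  have hr0 : (0 : ℝ) ≤ rVal b γ p := by
    rw [hr]; exact_mod_cast Int.emod_nonneg _ (by omega)
  have hrp : (rVal b γ p : ℝ) ≤ p := by
    rw [hr]; exact_mod_cast (Int.emod_lt_of_pos _ (by omega)).le
  have ht : (tVal b γ : ℝ) = rVal b γ p + betaVal b γ p * p := by
    rw [rVal]; push_cast; ring
  rcases le_or_gt (betaVal b γ p + 1) N with hN | hN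
  · have : ((betaVal b γ p : ℝ) + 1) ≤ N := by exact_mod_cast hN
    nlinarith
  · have : (N : ℝ) ≤ betaVal b γ p := by exact_mod_cast Int.lt_add_one_iff.1 hN
    nlinarith

end Circuit

section Slices

variable [NeZero n] {ℓ : Fin m → ZMod n} {k : Fin m → ℕ} {b : Fin m → ℤ} {x : ZMod n → ℝ}

/-- The slices of `Q(A, b)` at integer levels are integral. -/
theorem mem_Qstar_of_sum_eq_intCast (hA : circBounds n k)
    (hx : x ∈ Qpoly (circMatrix ℓ k) (fun i => (b i : ℝ))) {N : ℤ} (hN : ∑ j, x j = N) :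
    x ∈ Qstar (circMatrix ℓ k) (fun i => (b i : ℝ)) := by
  obtain ⟨f, hf⟩ := exists_eq_ofPotential x
  rw [hN] at hf
  rw [mem_Qpoly_iff_slack_nonneg, hf] at hx
  rw [hf]
  refine mem_convexHull_floor f _ (fun j => j) (fun j => j - 1)
    (fun j => if j = 0 then (N : ℝ) else 0) fun θ => ⟨fun j =>
      ⟨⌊f j + θ⌋ - ⌊f (j - 1) + θ⌋ + if j = 0 then N else 0, by push_cast; rfl⟩, ?_⟩
  change ofPotential (fun j => (⌊f j + θ⌋ : ℝ)) N ∈ _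
  rw [mem_Qpoly_iff_slack_nonneg]
  intro a
  have h := hx a
  rw [slack, load_ofPotential hA] at h ⊢
  have hfloor : ∀ (y z : ℝ) (d : ℤ), 0 ≤ y - z + d → (0 : ℝ) ≤ ⌊y + θ⌋ - ⌊z + θ⌋ + d := by
    intro y z d hd
    have : ⌊z + θ⌋ ≤ ⌊y + θ + d⌋ := Int.floor_mono (by linarith)
    rw [Int.floor_add_intCast] at this
    have h' : ((⌊z + θ⌋ : ℤ) : ℝ) ≤ ((⌊y + θ⌋ + d : ℤ) : ℝ) := by exact_mod_cast this
    push_cast at h'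
    linarith
  rcases (show a.sign = 1 ∨ a.sign = -1 by cases a <;> simp [sign]) with hs | hs
  · have := hfloor (f (a.head ℓ k)) (f (a.tail ℓ k)) (N * a.cross ℓ k - a.demand b)
      (by rw [hs] at h; push_cast at h ⊢; linarith)
    rw [hs]; push_cast at this ⊢; linarith
  · have := hfloor (f (a.tail ℓ k)) (f (a.head ℓ k)) (N * a.cross ℓ k - a.demand b)
      (by rw [hs] at h; push_cast at h ⊢; linarith)
    rw [hs]; push_cast at this ⊢; linarith

theorem Arc.load_add_smul (a : Arc m n) (x y : ZMod n → ℝ) (c d : ℝ) :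
    a.load ℓ k (fun j => c * x j + d * y j) = c * a.load ℓ k x + d * a.load ℓ k y := by
  cases a <;> simp only [load, mul_add, Finset.sum_add_distrib, Finset.mul_sum, mul_left_comm]

/-- If no circuit has negative cost at a point `x` of fractional level `N + 1 - μ`, then `x` lies
between the slices at levels `N` and `N + 1`. -/
theorem mem_Qstar_of_cost_nonneg (hA : circBounds n k) {N : ℤ} {μ : ℝ} (h0 : 0 < μ) (h1 : μ < 1)
    (hσ : ∑ j, x j = N + 1 - μ)
    (hc : ∀ γ ≠ [], ∀ u, IsWalk (Arc.tail ℓ k) (Arc.head ℓ k) u γ u →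
      (γ.map (Arc.tail ℓ k)).Nodup →
      0 ≤ (γ.map fun a : Arc m n => if a.sign = 1
        then μ * (a.slack ℓ k b x - (1 - μ) * a.cross ℓ k)
        else (1 - μ) * (a.slack ℓ k b x + μ * a.cross ℓ k)).sum) :
    x ∈ Qstar (circMatrix ℓ k) (fun i => (b i : ℝ)) := by
  obtain ⟨f, hf⟩ := exists_potential _ hc
  have h1' : 0 < 1 - μ := by linarith
  let w : ZMod n → ℝ := ofPotential f (μ * (1 - μ))
  let z : ZMod n → ℝ := fun j => 1 * x j + (1 - μ)⁻¹ * w j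
  let y : ZMod n → ℝ := fun j => 1 * x j + (-μ⁻¹) * w j
  have hw : ∑ j, w j = μ * (1 - μ) := sum_ofPotential _ _
  have hslack : ∀ (a : Arc m n) (c : ℝ), a.slack ℓ k b (fun j => 1 * x j + c * w j) =
      a.slack ℓ k b x + c * (a.sign * (f (a.head ℓ k) - f (a.tail ℓ k)) +
        μ * (1 - μ) * a.cross ℓ k) := by
    intro a c
    rw [slack, load_add_smul, load_ofPotential hA, slack]
    ring
  have hz : z ∈ Qpoly (circMatrix ℓ k) (fun i => (b i : ℝ)) := by
    refine mem_Qpoly_of_forall_sign (-1) (.inr rfl) fun a ha => ?_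
    have h := hf a
    rw [if_neg (by rw [ha]; decide)] at h
    rw [hslack, ha]
    refine nonneg_of_mul_nonneg_right (a := 1 - μ) ?_ h1'
    rw [mul_add, mul_inv_cancel_left₀ h1'.ne']
    push_cast
    linarith
  have hy : y ∈ Qpoly (circMatrix ℓ k) (fun i => (b i : ℝ)) := by
    refine mem_Qpoly_of_forall_sign 1 (.inl rfl) fun a ha => ?_
    have h := hf a
    rw [if_pos ha] at h
    rw [hslack, ha]
    refine nonneg_of_mul_nonneg_right (a := μ) ?_ h0
    rw [mul_add, neg_mul, mul_neg, mul_inv_cancel_left₀ h0.ne']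
    push_cast
    linarith
  have hzσ : ∑ j, z j = ((N + 1 : ℤ) : ℝ) := by
    simp only [z, Finset.sum_add_distrib, ← Finset.mul_sum, hσ, hw]
    field_simp
    push_cast
    ring
  have hyσ : ∑ j, y j = (N : ℝ) := by
    simp only [y, Finset.sum_add_distrib, ← Finset.mul_sum, hσ, hw]
    field_simp
    ring
  have hxyz : x = μ • y + (1 - μ) • z := by
    ext j
    simp only [y, z, Pi.add_apply, Pi.smul_apply, smul_eq_mul]
    field_simp
    ring
  rw [hxyz]
  exact convex_convexHull ℝ _ (mem_Qstar_of_sum_eq_intCast hA hy hyσ)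
    (mem_Qstar_of_sum_eq_intCast hA hz hzσ) h0.le h1'.le (by ring)

/-- The `Γ`-inequalities imply that no circuit has negative cost. -/
theorem cost_nonneg_of_gammaIneqHolds (hA : circBounds n k)
    (hx : x ∈ Qpoly (circMatrix ℓ k) (fun i => (b i : ℝ)))
    (hΓ : ∀ (γ : List (Arc m n)) (p : ℤ), IsCircuit ℓ k γ →
      p * (n : ℤ) = windingSum k γ → 2 ≤ p → ¬ (p ∣ tVal b γ) → GammaIneqHolds ℓ k b γ p x)
    {N : ℤ} {μ : ℝ} (h0 : 0 < μ) (h1 : μ < 1) (hσ : ∑ j, x j = N + 1 - μ)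
    {γ : List (Arc m n)} (hne : γ ≠ []) {u : ZMod n}
    (hw : IsWalk (Arc.tail ℓ k) (Arc.head ℓ k) u γ u) (hnd : (γ.map (Arc.tail ℓ k)).Nodup) :
    0 ≤ (γ.map fun a => if a.sign = 1 then μ * (a.slack ℓ k b x - (1 - μ) * a.cross ℓ k)
        else (1 - μ) * (a.slack ℓ k b x + μ * a.cross ℓ k)).sum := by
  rw [hw.sum_cost hA, hσ]
  have hp := hw.windingSum_eq hA
  have hfwd := hw.fwdSlack_nonneg hA hx
  have hrev := revSlack_nonneg (γ := γ) hx
  rw [hσ] at hfwd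
  generalize (γ.map fun a => a.sign * a.cross ℓ k).sum = p at hp hfwd ⊢
  rcases le_or_gt (tVal b γ) (N * p) with hlo | hlo
  · have : (tVal b γ : ℝ) ≤ N * p := by exact_mod_cast hlo
    nlinarith
  rcases le_or_gt ((N + 1) * p) (tVal b γ) with hhi | hhi
  · have : ((N : ℝ) + 1) * p ≤ tVal b γ := by exact_mod_cast hhi
    nlinarith
  have hp2 : 2 ≤ p := by linarith [add_one_mul N p]
  have hβ : betaVal b γ p = N := by
    rw [betaVal, Int.fdiv_eq_ediv_of_nonneg _ (by omega)]
    exact le_antisymm (Int.lt_add_one_iff.1 (Int.ediv_lt_of_lt_mul (by omega) hhi))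
      (Int.le_ediv_of_mul_le (by omega) hlo.le)
  have hdvd : ¬ p ∣ tVal b γ := by
    rintro ⟨q, hq⟩
    rw [hq, mul_comm p] at hlo hhi
    have h1 := lt_of_mul_lt_mul_right hlo (by omega)
    have h2 := lt_of_mul_lt_mul_right hhi (by omega)
    omega
  have key := gammaIneqHolds_iff.1 (hΓ γ p (hw.isCircuit hne hnd) hp hp2 hdvd)
  rw [rVal, hβ, hσ] at key
  push_cast at key
  linarith

theorem convex_Qpoly_inter_gammaIneqHolds :
    Convex ℝ {x : ZMod n → ℝ | x ∈ Qpoly (circMatrix ℓ k) (fun i => (b i : ℝ)) ∧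
      ∀ (γ : List (Arc m n)) (p : ℤ), IsCircuit ℓ k γ →
        p * (n : ℤ) = windingSum k γ → 2 ≤ p → ¬ (p ∣ tVal b γ) →
        GammaIneqHolds ℓ k b γ p x} := by
  have key : ∀ (c : ZMod n → ℝ) (r : ℝ), Convex ℝ {x : ZMod n → ℝ | r ≤ ∑ j, c j * x j} :=
    fun c r => convex_halfSpace_ge
      ⟨fun x y => by simp [mul_add, Finset.sum_add_distrib],
        fun a x => by simp [Finset.mul_sum, mul_left_comm]⟩ r
  rintro x ⟨⟨hx, hAx⟩, hΓx⟩ y ⟨⟨hy, hAy⟩, hΓy⟩ c d hc hd hcd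
  refine ⟨⟨fun j => ?_, fun i => key _ _ (hAx i) (hAy i) hc hd hcd⟩,
    fun γ p h1 h2 h3 h4 => key _ _ (hΓx γ p h1 h2 h3 h4) (hΓy γ p h1 h2 h3 h4) hc hd hcd⟩
  exact add_nonneg (mul_nonneg hc (hx j)) (mul_nonneg hd (hy j))

end Slices

/-- `Q*(A, b)` is completely described by `x ≥ 0`, `A x ≥ b` and the
`Γ`-inequalities over all simple directed circuits `Γ` in `D(A)` with `p(Γ) ≥ 2` such
that `p(Γ)` does not divide `t(Γ, b)`. -/
theorem Qstar_complete_description {m n : ℕ} [NeZero n] (ℓ : Fin m → ZMod n)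
    (k : Fin m → ℕ) (hA : circBounds n k) (b : Fin m → ℤ) (hb : ∀ i, 0 ≤ b i) :
    Qstar (circMatrix ℓ k) (fun i => (b i : ℝ)) =
      {x | x ∈ Qpoly (circMatrix ℓ k) (fun i => (b i : ℝ)) ∧
        ∀ (γ : List (Arc m n)) (p : ℤ), IsCircuit ℓ k γ →
          p * (n : ℤ) = windingSum k γ → 2 ≤ p → ¬ (p ∣ tVal b γ) →
          GammaIneqHolds ℓ k b γ p x} := by
  refine Set.Subset.antisymm (convexHull_min ?_ convex_Qpoly_inter_gammaIneqHolds) ?_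
  · rintro x ⟨hint, hx⟩
    exact ⟨hx, fun γ p hγ hp h2 _ => gammaIneqHolds_of_isIntegerPoint hA hγ hp h2 hint hx⟩
  · rintro x ⟨hx, hΓ⟩
    have hfl := Int.floor_add_fract (∑ j, x j)
    rcases (Int.fract_nonneg (∑ j, x j)).eq_or_lt with hfr | hfr
    · exact mem_Qstar_of_sum_eq_intCast hA hx (N := ⌊∑ j, x j⌋) (by linarith)
    · have hlt := Int.fract_lt_one (∑ j, x j)
      have h0 : 0 < 1 - Int.fract (∑ j, x j) := by linarith
      have h1 : 1 - Int.fract (∑ j, x j) < 1 := by linarith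
      have hσ : ∑ j, x j = ⌊∑ j, x j⌋ + 1 - (1 - Int.fract (∑ j, x j)) := by linarith
      exact mem_Qstar_of_cost_nonneg hA h0 h1 hσ fun γ hne u hw hnd =>
        cost_nonneg_of_gammaIneqHolds hA hx hΓ h0 h1 hσ hne hw hnd

end CircCover
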